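/- Conformable fractional Noether theorem: let 0 < α < 1, a < b, L : [a,b]×ℝ×ℝ → ℝ be of class C¹, and y : [a,b] → ℝ be left α-differentiable with conformable derivative y^(α)_a such that y^(α)_a is left α-differentiable and p(x) = (∂L/∂v)(x,y(x),y^(α)_a(x)) is left α-differentiable on (a,b). Let T, X, G : [a,b] → ℝ be left α-differentiable with conformable derivatives T^(α)_a, X^(α)_a, G^(α)_a, assume the products x ↦ (L(x,y,y^(α)_a) − p·y^(α)_a)·T and x ↦ p·X·(x−a)^{1−α} are left α-differentiable on (a,b), assume y satisfies the Euler–Lagrange equation (∂L/∂y)(x,y,y^(α)_a) − p^(α)_a = 0 on (a,b), and assume the necessary condition of invariance holds on (a,b): (∂L/∂x)T + (∂L/∂y)X + (∂L/∂v)[X^(α)_a − y^(α)_a((α−1)T/(x−a) + T^(α)_a/(x−a)^{1−α})] + L·T^(α)_a/(x−a)^{1−α} = G^(α)_a, with partials of L at (x,y(x),y^(α)_a(x)). Then for all x ∈ (a,b): (d^α_a/dx^α)[ (L − p·y^(α)_a)·T + p·X·(x−a)^{1−α} ] = (1−α)·p·[ X·(x−a)^{1−2α} − y^(α)_a·T/(x−a)^{α}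 ] + G^(α)_a·(x−a)^{1−α}. -/

import Mathlib

open Topology Filter

/-- `f` has left conformable fractional derivative `l` of order `α` starting from `a`,
at the point `x`. -/
def HasConfDerivAt (α a : ℝ) (f : ℝ → ℝ) (l x : ℝ) : Prop :=
  Filter.Tendsto (fun ε : ℝ => (f (x + ε * (x - a) ^ (1 - α)) - f x) / ε)
    (𝓝[≠] (0 : ℝ)) (𝓝 l)

theorem hasConfDerivAt_iff_hasDerivAt_comp {α a l x : ℝ} {f : ℝ → ℝ} :
    HasConfDerivAt α a f l x ↔
      HasDerivAt (fun ε : ℝ => f (x + ε * (x - a) ^ (1 - α))) l 0 := by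
  rw [hasDerivAt_iff_tendsto_slope_zero, HasConfDerivAt]
  simp only [zero_add, zero_mul, add_zero, smul_eq_mul, div_eq_inv_mul]

/-- Away from the base point, the conformable derivative is a multiple of the ordinary one. -/
theorem hasConfDerivAt_iff_hasDerivAt {α a l x : ℝ} {f : ℝ → ℝ} (hx : a < x) :
    HasConfDerivAt α a f l x ↔ HasDerivAt f (l / (x - a) ^ (1 - α)) x := by
  have hc : (x - a) ^ (1 - α) ≠ 0 := (Real.rpow_pos_of_pos (sub_pos.2 hx) _).ne'
  rw [hasConfDerivAt_iff_hasDerivAt_comp]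
  generalize (x - a) ^ (1 - α) = c at hc ⊢
  constructor
  · intro h
    have hg : HasDerivAt (fun t : ℝ => (t - x) / c) (1 / c) x :=
      ((hasDerivAt_id x).sub_const x).div_const c
    have h' : HasDerivAt (fun ε : ℝ => f (x + ε * c)) l ((x - x) / c) := by simpa using h
    have hcomp := (HasDerivAt.comp x h' hg).congr_deriv (mul_one_div l c)
    refine hcomp.congr_of_eventuallyEq (Eventually.of_forall fun t => ?_)
    simp [hc]
  · intro h
    have hg : HasDerivAt (fun ε : ℝ => x + ε * c) (1 * c) 0 :=
      ((hasDerivAt_id (0 : ℝ)).mul_const c).const_add x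
    have h' : HasDerivAt f (l / c) (x + 0 * c) := by simpa using h
    exact (HasDerivAt.comp (0 : ℝ) h' hg).congr_deriv (by field_simp)

/-- Chain rule for a differentiable function of three variables along a curve, in terms of its
partial derivatives. -/
theorem hasDerivAt_comp_curve {L : ℝ → ℝ → ℝ → ℝ} {u v : ℝ → ℝ} {u' v' x : ℝ}
    (hL : DifferentiableAt ℝ (fun q : ℝ × ℝ × ℝ => L q.1 q.2.1 q.2.2) (x, u x, v x))
    (hu : HasDerivAt u u' x) (hv : HasDerivAt v v' x) :
    HasDerivAt (fun t => L t (u t) (v t))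
      (deriv (fun t => L t (u x) (v x)) x + deriv (fun r => L x r (v x)) (u x) * u'
        + deriv (fun r => L x (u x) r) (v x) * v') x := by
  obtain ⟨D, hD⟩ := hL
  have h1 : HasDerivAt (fun t => L t (u x) (v x)) (D (1, 0, 0)) x :=
    HasFDerivAt.comp_hasDerivAt x (f := fun t => (t, u x, v x)) hD
      ((hasDerivAt_id x).prodMk ((hasDerivAt_const x (u x)).prodMk (hasDerivAt_const x (v x))))
  have h2 : HasDerivAt (fun r => L x r (v x)) (D (0, 1, 0)) (u x) :=
    HasFDerivAt.comp_hasDerivAt (u x) (f := fun r => (x, r, v x)) hD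
      ((hasDerivAt_const (u x) x).prodMk ((hasDerivAt_id (u x)).prodMk
        (hasDerivAt_const (u x) (v x))))
  have h3 : HasDerivAt (fun r => L x (u x) r) (D (0, 0, 1)) (v x) :=
    HasFDerivAt.comp_hasDerivAt (v x) (f := fun r => (x, u x, r)) hD
      ((hasDerivAt_const (v x) x).prodMk ((hasDerivAt_const (v x) (u x)).prodMk
        (hasDerivAt_id (v x))))
  have h : HasDerivAt (fun t => L t (u t) (v t)) (D (1, u', v')) x :=
    HasFDerivAt.comp_hasDerivAt x (f := fun t => (t, u t, v t)) hD
      ((hasDerivAt_id x).prodMk (hu.prodMk hv))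
  rw [h1.deriv, h2.deriv, h3.deriv]
  refine h.congr_deriv ?_
  have : ((1 : ℝ), u', v') = (1, 0, 0) + u' • (0, 1, 0) + v' • (0, 0, 1) := by simp
  rw [this, map_add, map_add, map_smul, map_smul, smul_eq_mul, smul_eq_mul]
  ring

/-- The conformable fractional Noether theorem: along any extremal `y` of
`J(y)=∫_a^b L(x,y,y^{(α)}_a)(x−a)^{α−1}dx` which is invariant under `x̄=x+ετ`, `ȳ=y+εξ`
up to the Gauge term `Λ` (i.e. the necessary condition of invariance holds),
`(d^α_a/dx^α)[(L − p·y^{(α)}_a)·τ + p·ξ·(x−a)^{1−α}]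
  = (1−α)·p·[ξ(x−a)^{1−2α} − y^{(α)}_a·τ/(x−a)^α] + Λ^{(α)}_a·(x−a)^{1−α}`,
where `p = ∂L/∂v`. Here `T,X,G` denote `τ, ξ, Λ` evaluated along `y`. -/
theorem conformable_noether
    (α a b : ℝ) (hα0 : 0 < α) (hα1 : α < 1) (hab : a < b)
    (L : ℝ → ℝ → ℝ → ℝ)
    (hL : ContDiff ℝ 1 (fun q : ℝ × ℝ × ℝ => L q.1 q.2.1 q.2.2))
    (y yα yαα p pα T Tα X Xα G Gα : ℝ → ℝ)
    (hy : ∀ x ∈ Set.Icc a b, HasConfDerivAt α a y (yα x) x)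
    (hyα : ∀ x ∈ Set.Ioo a b, HasConfDerivAt α a yα (yαα x) x)
    (hpdef : ∀ x, p x = deriv (fun v => L x (y x) v) (yα x))
    (hp : ∀ x ∈ Set.Ioo a b, HasConfDerivAt α a p (pα x) x)
    (hT : ∀ x ∈ Set.Ioo a b, HasConfDerivAt α a T (Tα x) x)
    (hX : ∀ x ∈ Set.Ioo a b, HasConfDerivAt α a X (Xα x) x)
    (hG : ∀ x ∈ Set.Ioo a b, HasConfDerivAt α a G (Gα x) x)
    (hprod1 : ∀ x ∈ Set.Ioo a b, ∃ l,
      HasConfDerivAt α a (fun t => (L t (y t) (yα t) - p t * yα t) * T t) l x)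
    (hprod2 : ∀ x ∈ Set.Ioo a b, ∃ l,
      HasConfDerivAt α a (fun t => p t * X t * (t - a) ^ (1 - α)) l x)
    (hEL : ∀ x ∈ Set.Ioo a b, deriv (fun u => L x u (yα x)) (y x) - pα x = 0)
    (hinv : ∀ x ∈ Set.Ioo a b,
      deriv (fun t => L t (y x) (yα x)) x * T x
        + deriv (fun u => L x u (yα x)) (y x) * X x
        + deriv (fun v => L x (y x) v) (yα x) *
            (Xα x - yα x * ((α - 1) * T x / (x - a) + Tα x / (x - a) ^ (1 - α)))
        + L x (y x) (yα x) * Tα x / (x - a) ^ (1 - α) = Gα x) :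
    ∀ x ∈ Set.Ioo a b,
      HasConfDerivAt α a
        (fun t => (L t (y t) (yα t) - p t * yα t) * T t + p t * X t * (t - a) ^ (1 - α))
        ((1 - α) * p x * (X x * (x - a) ^ (1 - 2 * α) - yα x * T x / (x - a) ^ α)
          + Gα x * (x - a) ^ (1 - α)) x := by
  intro x hx
  have hs : 0 < x - a := sub_pos.2 hx.1
  have hc : (x - a) ^ (1 - α) ≠ 0 := (Real.rpow_pos_of_pos hs _).ne'
  have hd : (x - a) ^ α ≠ 0 := (Real.rpow_pos_of_pos hs _).ne'
  have hcd : x - a = (x - a) ^ (1 - α) * (x - a) ^ α := by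
    rw [← Real.rpow_add hs, sub_add_cancel, Real.rpow_one]
  have h2α : (x - a) ^ (1 - 2 * α) = (x - a) ^ (1 - α) / (x - a) ^ α := by
    rw [← Real.rpow_sub hs]
    congr 1
    ring
  have hpow : HasDerivAt (fun t : ℝ => (t - a) ^ (1 - α)) ((1 - α) / (x - a) ^ α) x := by
    have h := ((hasDerivAt_id x).sub_const a).rpow_const (p := 1 - α) (Or.inl hs.ne')
    refine h.congr_deriv ?_
    rw [sub_sub_cancel_left, id_eq, Real.rpow_neg hs.le]
    ring
  have hy' := (hasConfDerivAt_iff_hasDerivAt hx.1).1 (hy x (Set.Ioo_subset_Icc_self hx))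
  have hyα' := (hasConfDerivAt_iff_hasDerivAt hx.1).1 (hyα x hx)
  have hp' := (hasConfDerivAt_iff_hasDerivAt hx.1).1 (hp x hx)
  have hT' := (hasConfDerivAt_iff_hasDerivAt hx.1).1 (hT x hx)
  have hX' := (hasConfDerivAt_iff_hasDerivAt hx.1).1 (hX x hx)
  have hL' := hasDerivAt_comp_curve (hL.differentiable one_ne_zero (x, y x, yα x)) hy' hyα'
  have hE := hEL x hx
  have hI := hinv x hx
  rw [← hpdef x] at hL' hI
  rw [sub_eq_zero] at hE
  rw [hE] at hL' hI
  rw [hasConfDerivAt_iff_hasDerivAt hx.1]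
  refine (((hL'.sub (hp'.mul hyα')).mul hT').add ((hp'.mul hX').mul hpow)).congr_deriv ?_
  simp only [Pi.sub_apply, Pi.mul_apply]
  rw [← hI, h2α]
  rw [show (α - 1) * T x / (x - a)
    = (α - 1) * T x / ((x - a) ^ (1 - α) * (x - a) ^ α) by rw [← hcd]]
  generalize (x - a) ^ (1 - α) = c at hc ⊢
  generalize (x - a) ^ α = d at hd ⊢
  field_simp
  ring
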